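/- Let (X, μ) be a β-homogeneous probabilistic modular space (0 < β ≤ 1) satisfying condition (Υ). If x ∈ X is nonzero, then there exist α₀ ∈ (0,1) and t₀ > 0 such that the μ-balls B(0, α₀, t₀/2^{β+1}) and B(x, α₀, t₀/2^{β+1}) are disjoint. -/

import Mathlib

open Set

/-- A probabilistic modular space structure on a real vector space `X`:
`mu x` is a nondecreasing function `ℝ → ℝ` with infimum 0 and supremum 1,
satisfying the axioms of a probabilistic modular. -/
structure ProbModular (X : Type*) [AddCommGroup X] [Module ℝ X] where
  mu : X → ℝ → ℝ
  mono : ∀ x, Monotone (mu x)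
  iInf_mu : ∀ x, ⨅ t : ℝ, mu x t = 0
  iSup_mu : ∀ x, ⨆ t : ℝ, mu x t = 1
  mu_zero : ∀ x, mu x 0 = 0
  mu_eq_one_iff : ∀ x, (∀ t : ℝ, 0 < t → mu x t = 1) ↔ x = 0
  mu_neg : ∀ x t, mu (-x) t = mu x t
  mu_convex : ∀ (x y : X) (a b s t : ℝ), 0 ≤ a → 0 ≤ b → a + b = 1 → 0 ≤ s → 0 ≤ t →
    min (mu x s) (mu y t) ≤ mu (a • x + b • y) (s + t)

variable {X : Type*} [AddCommGroup X] [Module ℝ X]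

/-- The μ-ball `B(x, α, t) = {y : μ_{x-y}(t) > 1 - α}`. -/
def pmBall (μ : ProbModular X) (x : X) (α t : ℝ) : Set X :=
  {y : X | 1 - α < μ.mu (x - y) t}

/-- Every `μ_x` is left-continuous on `ℝ`. -/
def ProbModular.LeftContinuous (μ : ProbModular X) : Prop :=
  ∀ (x : X) (t : ℝ), ContinuousWithinAt (μ.mu x) (Set.Iic t) t

/-- The Δ₂-condition with constant `c`: `μ_{2x}(t) ≥ μ_x(t/c)` for all `x` and `t > 0`. -/
def ProbModular.Delta2 (μ : ProbModular X) (c : ℝ) : Prop :=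
  ∀ (x : X) (t : ℝ), 0 < t → μ.mu x (t / c) ≤ μ.mu ((2 : ℝ) • x) t

/-- β-homogeneity: `μ_{a x}(t) = μ_x(t / |a|^β)` for all `x`, `t > 0`, nonzero `a`. -/
def ProbModular.IsHomog (μ : ProbModular X) (β : ℝ) : Prop :=
  ∀ (x : X) (t a : ℝ), 0 < t → a ≠ 0 → μ.mu (a • x) t = μ.mu x (t / |a| ^ β)

/-- Condition (Υ): for any nonzero `x`, `μ_x` is continuous on `ℝ` and strictly
increasing on `{t : 0 < μ_x(t) < 1}`. -/
def ProbModular.Upsilon (μ : ProbModular X) : Prop :=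
  ∀ x : X, x ≠ 0 → Continuous (μ.mu x) ∧
    StrictMonoOn (μ.mu x) {t : ℝ | 0 < μ.mu x t ∧ μ.mu x t < 1}

theorem ProbModular.mu_le_one (μ : ProbModular X) (x : X) (t : ℝ) : μ.mu x t ≤ 1 := by
  have hbdd : BddAbove (range (μ.mu x)) := by
    by_contra h
    have h_sup := μ.iSup_mu x
    rw [Real.iSup_of_not_bddAbove h] at h_sup
    exact zero_ne_one h_sup
  exact (le_ciSup hbdd t).trans_eq (μ.iSup_mu x)

theorem ProbModular.exists_pos_mu_lt_one (μ : ProbModular X) {x : X} (hx : x ≠ 0) :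
    ∃ t : ℝ, 0 < t ∧ μ.mu x t < 1 := by
  by_contra! h
  exact hx ((μ.mu_eq_one_iff x).1 fun t ht => (μ.mu_le_one x t).antisymm (h t ht))

/-- Midpoint convexity combined with homogeneity, as a triangle inequality for `mu`. -/
theorem ProbModular.IsHomog.min_mu_le {μ : ProbModular X} {β : ℝ} (hhom : μ.IsHomog β)
    (x y : X) {t : ℝ} (ht : 0 < t) :
    min (μ.mu x (t / 2 ^ (β + 1))) (μ.mu y (t / 2 ^ (β + 1))) ≤ μ.mu (x + y) t := by
  have hpow : (0 : ℝ) < 2 ^ β := Real.rpow_pos_of_pos two_pos β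
  have hs : 0 < t / (2 : ℝ) ^ (β + 1) := by positivity
  have hconv := μ.mu_convex x y (1 / 2) (1 / 2) _ _ (by norm_num) (by norm_num) (by norm_num)
    hs.le hs.le
  rw [← smul_add, hhom _ _ _ (add_pos hs hs) (by norm_num)] at hconv
  convert hconv using 2
  rw [abs_of_pos (by norm_num), one_div, Real.inv_rpow two_pos.le,
    Real.rpow_add_one two_ne_zero]
  field_simp
  norm_num

theorem stmt9 (μ : ProbModular X) (β : ℝ) (hβ0 : 0 < β) (hβ1 : β ≤ 1)
    (hhom : μ.IsHomog β) (hups : μ.Upsilon) (x : X) (hx : x ≠ 0) :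
    ∃ α₀ t₀ : ℝ, α₀ ∈ Set.Ioo (0 : ℝ) 1 ∧ 0 < t₀ ∧
      Disjoint (pmBall μ 0 α₀ (t₀ / 2 ^ (β + 1))) (pmBall μ x α₀ (t₀ / 2 ^ (β + 1))) := by
  obtain ⟨t, ht, hlt⟩ := μ.exists_pos_mu_lt_one hx
  refine ⟨min (1 - μ.mu x t) (1 / 2), t,
    ⟨lt_min (sub_pos.2 hlt) (by norm_num), (min_le_right _ _).trans_lt (by norm_num)⟩, ht, ?_⟩
  rw [Set.disjoint_left]
  intro y hy hxy
  simp only [pmBall, mem_ofPred_eq, zero_sub, μ.mu_neg] at hy hxy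
  have h_sum := (lt_min hxy hy).trans_le (hhom.min_mu_le (x - y) y ht)
  rw [sub_add_cancel] at h_sum
  linarith [min_le_left (1 - μ.mu x t) (1 / 2)]
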